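/- A training trajectory each of whose steps satisfies the fairness-preserving derivative condition keeps the model individually fair at every iteration. Precisely: let E be a real normed vector space, let X and S be types, let f : X → S → E → ℝ, and let θ : ℕ → E be a sequence of parameter states. Assume: (i) f x s₁ (θ 0) = f x s₂ (θ 0) for all x ∈ X and s₁, s₂ ∈ S (the initialisation is individually fair); and (ii) for every t ∈ ℕ, writing K_t = segment ℝ (θ t) (θ (t+1)), for every x ∈ X and s ∈ S the map θ' ↦ f x s θ' is differentiable within K_t at every point of K_t, and for every point ϑ ∈ K_t and all x ∈ X, s₁, s₂ ∈ S, fderivWithin ℝ (fun θ' => f x s₁ θ') K_t ϑ = fderivWithin ℝ (fun θ' => f x s₂ θ') K_t ϑ. Then for every T ∈ ℕ, f x s₁ (θ T) = f x s₂ (θ T) for all x ∈ X and s₁, s₂ ∈ S. -/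

import Mathlib

/-- A training trajectory each of whose steps satisfies the fairness-preserving
derivative condition keeps the model individually fair at every iteration:
fair initialisation plus fairness-preserving updates yields a model that is
individually fair after any number of training steps. -/
theorem fair_along_training_trajectory
    {E : Type*} [NormedAddCommGroup E] [NormedSpace ℝ E]
    {X S : Type*} (f : X → S → E → ℝ) (θ : ℕ → E)
    (hinit : ∀ (x : X) (s₁ s₂ : S), f x s₁ (θ 0) = f x s₂ (θ 0))
    (hstep : ∀ t : ℕ,
      (∀ (x : X) (s : S), ∀ ϑ ∈ segment ℝ (θ t) (θ (t + 1)),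
        DifferentiableWithinAt ℝ (fun θ' => f x s θ') (segment ℝ (θ t) (θ (t + 1))) ϑ) ∧
      (∀ ϑ ∈ segment ℝ (θ t) (θ (t + 1)), ∀ (x : X) (s₁ s₂ : S),
        fderivWithin ℝ (fun θ' => f x s₁ θ') (segment ℝ (θ t) (θ (t + 1))) ϑ
          = fderivWithin ℝ (fun θ' => f x s₂ θ') (segment ℝ (θ t) (θ (t + 1))) ϑ)) :
    ∀ T : ℕ, ∀ (x : X) (s₁ s₂ : S), f x s₁ (θ T) = f x s₂ (θ T) := by
  intro T
  induction T with
  | zero => exact hinit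
  | succ t ih =>
    intro x s₁ s₂
    obtain ⟨hd, he⟩ := hstep t
    have hder : ∀ ϑ ∈ segment ℝ (θ t) (θ (t + 1)),
        HasFDerivWithinAt (fun θ' => f x s₁ θ' - f x s₂ θ') (0 : E →L[ℝ] ℝ)
          (segment ℝ (θ t) (θ (t + 1))) ϑ := by
      intro ϑ hϑ
      have h1 := (hd x s₁ ϑ hϑ).hasFDerivWithinAt
      have h2 := (hd x s₂ ϑ hϑ).hasFDerivWithinAt
      rw [he ϑ hϑ x s₁ s₂] at h1
      have h3 := h1.fun_sub h2
      rwa [sub_self] at h3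
    have key := Convex.norm_image_sub_le_of_norm_hasFDerivWithin_le (C := 0) hder
      (fun _ _ => by simp) (convex_segment (θ t) (θ (t + 1)))
      (left_mem_segment ℝ _ _) (right_mem_segment ℝ _ _)
    have h0 := ih x s₁ s₂
    rw [zero_mul, norm_le_zero_iff] at key
    linarith
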